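/- (Littlewood) For every n ≥ 0, the plethysm h_n[h_2] of complete homogeneous symmetric functions equals the sum of Schur functions s_λ over all partitions λ of 2n all of whose parts are even. -/

import Mathlib

open MvPolynomial

/-- The ring of symmetric functions, modeled as the polynomial ring
`ℚ[h₁, h₂, …]` in the complete homogeneous symmetric functions (variable `i`
corresponds to `h_{i+1}`). -/
abbrev SymF : Type := MvPolynomial ℕ ℚ

/-- The complete homogeneous symmetric function `h_n` as an element of `SymF`. -/
noncomputable def hh : ℕ → SymF
  | 0 => 1
  | n + 1 => X n

/-- The expression of `h_n` in terms of the power sums (in the polynomial ring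
`ℚ[p₁, p₂, …]`, variable `i` corresponding to `p_{i+1}`), via Newton's identity
`n·h_n = ∑_{i=1}^n p_i h_{n-i}`. -/
noncomputable def hInP : ℕ → MvPolynomial ℕ ℚ
  | 0 => 1
  | n + 1 =>
      ((n + 1 : ℚ))⁻¹ • ∑ i ∈ Finset.range (n + 1), X i * hInP (n - i)
  termination_by n => n
  decreasing_by omega

/-- The power sum symmetric function `p_n` as an element of `SymF`, via Newton's
identity `p_n = n·h_n - ∑_{i=1}^{n-1} p_i h_{n-i}`. -/
noncomputable def pSym : ℕ → SymF
  | 0 => 1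
  | n + 1 =>
      ((n : ℚ) + 1) • hh (n + 1) -
        ∑ i ∈ (Finset.range n).attach, pSym (i.1 + 1) * hh (n - i.1)
  termination_by n => n
  decreasing_by
    have h := Finset.mem_range.mp i.2
    omega

/-- The isomorphism expressing a symmetric function in the power sum basis. -/
noncomputable def toP : SymF →ₐ[ℚ] MvPolynomial ℕ ℚ :=
  aeval (fun i => hInP (i + 1))

/-- `psub k g = p_k[g]`, plethysm of a power sum with `g`: substitute `p_i ↦ p_{ik}`
in the power-sum expression of `g`. -/
noncomputable def psub (k : ℕ) (g : SymF) : SymF :=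
  aeval (fun i => pSym ((i + 1) * k)) (toP g)

/-- Plethysm `f[g]` of symmetric functions: substitute `p_k ↦ p_k[g]` in the
power-sum expression of `f`. -/
noncomputable def pleth (f g : SymF) : SymF :=
  aeval (fun i => psub (i + 1) g) (toP f)

/-- `h_z` for integer index: zero for negative `z`. -/
noncomputable def hZ (z : ℤ) : SymF := if 0 ≤ z then hh z.toNat else 0

/-- The Schur function of a partition given as a weakly decreasing list of parts,
defined by the Jacobi–Trudi determinant `s_λ = det(h_{λ_i - i + j})`. -/
noncomputable def schur (l : List ℕ) : SymF :=
  (Matrix.of fun i j : Fin l.length =>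
    hZ ((l.get i : ℤ) + (j : ℤ) - (i : ℤ))).det

/-- `z_λ` for the monomial `d` in the power sums: `∏_i i^{m_i} m_i!`. -/
def zQ (d : ℕ →₀ ℕ) : ℚ :=
  d.prod fun i m => ((i : ℚ) + 1) ^ m * (Nat.factorial m : ℚ)

/-- The Hall inner product, characterized by `⟨p_λ, p_μ⟩ = δ_{λμ} z_λ`, computed in
the power sum basis. -/
noncomputable def hall (f g : SymF) : ℚ :=
  ∑ d ∈ (toP f).support, zQ d * (toP f).coeff d * (toP g).coeff d

/-- The decreasingly sorted list of parts of a partition. -/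
def sortedParts {N : ℕ} (π : Nat.Partition N) : List ℕ :=
  (π.parts.sort (· ≤ ·)).reverse

section Determinants

variable {R : Type*} [CommRing R]

theorem det_add_mul_eq_sum {n : Type*} [Fintype n] [DecidableEq n] (A B : Matrix n n R) (w : R) :
    (Matrix.of fun i j => A i j + w * B i j).det =
      ∑ S : Finset n, w ^ S.card *
        (Matrix.of fun i j => if i ∈ S then B i j else A i j).det := by
  have h := (Matrix.detRowAlternating (R := R) (n := n)).toMultilinearMap.map_add_univ
    (fun i j => w * B i j) (fun i j => A i j)
  have h1 : (Matrix.of fun i j => A i j + w * B i j) =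
      (fun i j => w * B i j) + (fun i j => A i j) := by
    ext i j; simp [add_comm]
  rw [h1]
  refine h.trans (Finset.sum_congr rfl fun S _ => ?_)
  have h2 := Matrix.det_mul_column (fun i => if i ∈ S then w else 1)
    (Matrix.of fun i j => if i ∈ S then B i j else A i j)
  rw [Finset.prod_ite_mem, Finset.univ_inter, Finset.prod_const] at h2
  rw [← h2]
  change Matrix.det _ = _
  congr 1
  ext i j
  by_cases hi : i ∈ S <;> simp [Finset.piecewise, hi]

/-- The Jacobi-Trudi determinant of an integer sequence, with entries taken from `f : ℤ → R`. -/
def jacobiTrudi (f : ℤ → R) (N : ℕ) (α : Fin N → ℤ) : R :=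
  (Matrix.of fun i j : Fin N => f (α i + (j : ℤ) - (i : ℤ))).det

/-- The indicator of a finite set, with integer values. -/
def ind {N : ℕ} (S : Finset (Fin N)) (i : Fin N) : ℤ := if i ∈ S then 1 else 0

theorem jacobiTrudi_add_mul_sub (f : ℤ → R) (N : ℕ) (α : Fin N → ℤ) (w : R) :
    jacobiTrudi (fun z => f z + w * f (z - 1)) N α =
      ∑ S : Finset (Fin N), w ^ S.card * jacobiTrudi f N (α - ind S) := by
  unfold jacobiTrudi
  refine (det_add_mul_eq_sum _ (Matrix.of fun i j : Fin N => f (α i + (j : ℤ) - (i : ℤ) - 1))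
    w).trans (Finset.sum_congr rfl fun S _ => ?_)
  congr 2
  ext i j
  by_cases hi : i ∈ S
  · simp only [Matrix.of_apply, ind, hi, if_true, Pi.sub_apply]
    congr 1; ring
  · simp [ind, hi]

theorem jacobiTrudi_add_mul_add (f : ℤ → R) (N : ℕ) (α : Fin N → ℤ) (w : R) :
    jacobiTrudi (fun z => f z + w * f (z + 1)) N α =
      ∑ S : Finset (Fin N), w ^ S.card * jacobiTrudi f N (α + ind S) := by
  unfold jacobiTrudi
  refine (det_add_mul_eq_sum _ (Matrix.of fun i j : Fin N => f (α i + (j : ℤ) - (i : ℤ) + 1))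
    w).trans (Finset.sum_congr rfl fun S _ => ?_)
  congr 2
  ext i j
  by_cases hi : i ∈ S
  · simp only [Matrix.of_apply, ind, hi, if_true, Pi.add_apply]
    congr 1; ring
  · simp [ind, hi]

theorem jacobiTrudi_eq_zero_of_step (f : ℤ → R) (m : ℕ) (α : Fin (m + 1) → ℤ) (i : Fin m)
    (h : α i.succ = α i.castSucc + 1) : jacobiTrudi f (m + 1) α = 0 := by
  refine Matrix.det_zero_of_row_eq (i := i.castSucc) (j := i.succ)
    (Fin.castSucc_lt_succ).ne ?_
  ext j
  simp only [Matrix.of_apply, h, Fin.val_succ, Fin.val_castSucc]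
  congr 1
  push_cast
  ring

theorem jacobiTrudi_eq_zero_of_last_neg (f : ℤ → R) (hf : ∀ z < 0, f z = 0) (m : ℕ)
    (α : Fin (m + 1) → ℤ) (h : α (Fin.last m) < 0) : jacobiTrudi f (m + 1) α = 0 := by
  refine Matrix.det_eq_zero_of_row_eq_zero (Fin.last m) fun j => ?_
  refine hf _ ?_
  have := j.is_le
  rw [Fin.val_last]
  omega

theorem jacobiTrudi_succ (f : ℤ → R) (hf : ∀ z < 0, f z = 0) (h0 : f 0 = 1) (m : ℕ)
    (α : Fin (m + 1) → ℤ) (h : α (Fin.last m) = 0) :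
    jacobiTrudi f (m + 1) α = jacobiTrudi f m (fun i => α i.castSucc) := by
  unfold jacobiTrudi
  rw [Matrix.det_succ_row _ (Fin.last m), Finset.sum_eq_single (Fin.last m)]
  · simp only [Matrix.of_apply, h, Fin.succAbove_last]
    simp only [zero_add, sub_self, h0, ← two_mul, pow_mul, Fin.val_last, mul_one]
    simp
    rfl
  · intro j _ hj
    have : (j : ℕ) < m := lt_of_le_of_ne j.is_le fun e => hj (Fin.ext e)
    simp only [Matrix.of_apply, h, Fin.val_last]
    rw [hf _ (by omega)]
    simp
  · simp

theorem jacobiTrudi_shift_mul (f : ℤ → R) (m : ℕ) (p : ℕ → R) (hp0 : p 0 = 1)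
    (hf : ∀ a > 0, ∑ k ∈ Finset.range (m + 2), p k * f (a - k) = 0)
    (α : Fin (m + 1) → ℤ) (hα : ∀ i, 0 ≤ α i) (w : R) :
    jacobiTrudi (fun z => f z + w * f (z + 1)) (m + 1) α =
      jacobiTrudi f (m + 1) α * ∑ k ∈ Finset.range (m + 2), p k * (-w) ^ k := by
  set M : Matrix (Fin (m + 1)) (Fin (m + 1)) R := Matrix.of fun i j =>
    (if i = j then 1 else 0) +
      w * (if j = Fin.last m then - p (m + 1 - i) else if (i : ℕ) = j + 1 then 1 else 0) with hM
  set T : Matrix (Fin (m + 1)) (Fin (m + 1)) R := Matrix.of fun i j =>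
    if i = Fin.last m then (-w) ^ (m - j) else if i = j then 1 else 0 with hT
  have hCM : (Matrix.of fun i j : Fin (m + 1) =>
      f (α i + (j : ℤ) - (i : ℤ)) + w * f (α i + (j : ℤ) - (i : ℤ) + 1)) =
      (Matrix.of fun i j : Fin (m + 1) => f (α i + (j : ℤ) - (i : ℤ))) * M := by
    ext i j
    simp only [hM, Matrix.mul_apply, Matrix.of_apply, mul_add, Finset.sum_add_distrib]
    congr 1
    · simp
    · by_cases hj : j = Fin.last m
      · subst hj
        have h := hf (α i + (Fin.last m : ℕ) - (i : ℤ) + 1) (by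
          have := hα i
          have := i.is_le
          simp only [Fin.val_last]; omega)
        rw [Finset.sum_range_succ', hp0, ← Finset.sum_range_reflect, Finset.sum_range] at h
        simp only [if_true]
        rw [Nat.cast_zero, sub_zero, one_mul, add_comm] at h
        rw [eq_neg_of_add_eq_zero_left h, ← Finset.sum_neg_distrib, Finset.mul_sum]
        refine Finset.sum_congr rfl fun x _ => ?_
        have hx := x.is_le
        have e1 : m + 1 - 1 - (x : ℕ) + 1 = m + 1 - x := by omega
        rw [e1, Fin.val_last]
        have e2 : α i + (m : ℤ) - (i : ℤ) + 1 - ((m + 1 - (x : ℕ) : ℕ) : ℤ) =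
            α i + (x : ℤ) - (i : ℤ) := by omega
        rw [e2]; ring
      · have hj' : (j : ℕ) < m := lt_of_le_of_ne j.is_le fun e => hj (Fin.ext e)
        simp only [hj, if_false]
        rw [Finset.sum_eq_single (⟨j + 1, by omega⟩ : Fin (m + 1))]
        · simp only [if_true, mul_one]
          have e : α i + ((j : ℕ) : ℤ) - (i : ℤ) + 1 = α i + ((j + 1 : ℕ) : ℤ) - (i : ℤ) := by
            push_cast; ring
          rw [e, mul_comm]
        · intro b _ hb
          rw [if_neg fun e => hb (Fin.ext e)]; simp
        · simp
  have hTdet : T.det = 1 := by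
    rw [Matrix.det_of_isLowerTriangular]
    · refine Finset.prod_eq_one fun i _ => ?_
      by_cases hi : i = Fin.last m
      · simp [hT, hi]
      · simp [hT, hi]
    · intro i j hij
      have hij' : i < j := hij
      have : i ≠ Fin.last m := (lt_of_lt_of_le hij' (Fin.le_last j)).ne
      simp [hT, this, hij'.ne]
  have hTM : (T * M).det = ∑ k ∈ Finset.range (m + 2), p k * (-w) ^ k := by
    have hlast : ∀ j, j ≠ Fin.last m → (T * M) (Fin.last m) j = 0 := by
      intro j hj
      have hj' : (j : ℕ) < m := lt_of_le_of_ne j.is_le fun e => hj (Fin.ext e)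
      simp only [hT, hM, Matrix.mul_apply, Matrix.of_apply, if_true, hj, if_false, mul_add,
        Finset.sum_add_distrib]
      rw [Finset.sum_eq_single j, Finset.sum_eq_single (⟨j + 1, by omega⟩ : Fin (m + 1))]
      · simp only [if_true]
        have : m - (j : ℕ) = m - (j + 1) + 1 := by omega
        rw [this]; ring
      · intro b _ hb
        rw [if_neg fun e => hb (Fin.ext e)]; simp
      · simp
      · intro b _ hb
        simp [hb]
      · simp
    have hll : (T * M) (Fin.last m) (Fin.last m) =
        ∑ k ∈ Finset.range (m + 2), p k * (-w) ^ k := by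
      simp only [hT, hM, Matrix.mul_apply, Matrix.of_apply, if_true, mul_add,
        Finset.sum_add_distrib]
      rw [Finset.sum_range_succ', hp0, ← Finset.sum_range_reflect, Finset.sum_range, add_comm]
      congr 1
      · refine Finset.sum_congr rfl fun x _ => ?_
        have hx := x.is_le
        have e1 : m + 1 - 1 - (x : ℕ) + 1 = m + 1 - x := by omega
        have e2 : m + 1 - (x : ℕ) = m - x + 1 := by omega
        rw [e1, e2, pow_succ]; ring
      · rw [Finset.sum_eq_single (Fin.last m)]
        · simp
        · intro b _ hb
          simp [hb]
        · simp
    rw [Matrix.det_succ_row _ (Fin.last m), Finset.sum_eq_single (Fin.last m)]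
    · rw [hll]
      have : ((T * M).submatrix (Fin.last m).succAbove (Fin.last m).succAbove).det = 1 := by
        have he : ∀ i j : Fin m, (T * M) i.castSucc j.castSucc = M i.castSucc j.castSucc := by
          intro i j
          simp [hT, Matrix.mul_apply, (Fin.castSucc_lt_last i).ne]
        rw [Matrix.det_of_isLowerTriangular]
        · refine Finset.prod_eq_one fun i _ => ?_
          simp only [Matrix.submatrix_apply, Fin.succAbove_last, he]
          simp [hM, (Fin.castSucc_lt_last i).ne]
        · intro i j hij
          have hij' : (i : ℕ) < j := hij
          simp only [Matrix.submatrix_apply, Fin.succAbove_last, he]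
          have h1 : i ≠ j := fun e => by simp [e] at hij'
          have h2 : ¬ (i : ℕ) = j + 1 := by omega
          simp [hM, (Fin.castSucc_lt_last j).ne, h1, h2]
      rw [this, ← two_mul, pow_mul]
      simp
    · intro j _ hj
      rw [hlast j hj]; simp
    · simp
  unfold jacobiTrudi
  rw [hCM, Matrix.det_mul, ← hTM, Matrix.det_mul, hTdet, one_mul]

end Determinants

section EvenSum

variable {R : Type*} [CommRing R]

theorem map_jacobiTrudi {S : Type*} [CommRing S] (φ : R →+* S) (f : ℤ → R) (N : ℕ)
    (α : Fin N → ℤ) : φ (jacobiTrudi f N α) = jacobiTrudi (fun z => φ (f z)) N α :=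
  RingHom.map_det φ _

/-- The Pieri rule for multiplication by an elementary symmetric function. -/
theorem mul_jacobiTrudi_eq_sum (f : ℤ → R) (m : ℕ) (p : ℕ → R) (hp0 : p 0 = 1)
    (hp : ∀ k ≥ m + 2, p k = 0)
    (hf : ∀ a > 0, ∑ k ∈ Finset.range (m + 2), p k * f (a - k) = 0)
    (α : Fin (m + 1) → ℤ) (hα : ∀ i, 0 ≤ α i) (k : ℕ) :
    (-1) ^ k * p k * jacobiTrudi f (m + 1) α =
      ∑ S : Finset (Fin (m + 1)), if k = S.card then jacobiTrudi f (m + 1) (α + ind S) else 0 := by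
  have h := (jacobiTrudi_add_mul_add (fun z => Polynomial.C (f z)) (m + 1) α Polynomial.X).symm.trans
    (jacobiTrudi_shift_mul (fun z => Polynomial.C (f z)) m (fun k => Polynomial.C (p k))
      (by simp [hp0]) (fun a ha => by simp_rw [← Polynomial.C_mul, ← map_sum, hf a ha, map_zero])
      α hα Polynomial.X)
  replace h := congrArg (Polynomial.coeff · k) h
  simp only [← map_jacobiTrudi, Polynomial.finsetSum_coeff, Polynomial.coeff_C_mul,
    Polynomial.coeff_X_pow_mul', Polynomial.coeff_C] at h
  have h1 : ∀ j, (-Polynomial.X : Polynomial R) ^ j = Polynomial.C ((-1) ^ j) * Polynomial.X ^ j := by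
    intro j
    rw [neg_pow]; simp
  simp only [h1, Polynomial.coeff_C_mul, Polynomial.coeff_X_pow, mul_ite, mul_one, mul_zero,
    Finset.sum_ite_eq, Finset.mem_range] at h
  calc _ = jacobiTrudi f (m + 1) α * if k < m + 2 then p k * (-1) ^ k else 0 := by
        split_ifs with hk
        · ring
        · rw [hp k (by omega)]; ring
    _ = _ := by
        rw [mul_ite, mul_zero, ← h]
        refine Finset.sum_congr rfl fun S _ => ?_
        by_cases hk : k = S.card
        · simp [hk]
        · rw [if_neg hk]
          split_ifs with h2 h3
          · omega
          · rfl
          · rfl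

open scoped Classical in
/-- Partitions of `n` with at most `N` parts, as weakly decreasing sequences of length `N`. -/
noncomputable def partSeq (N n : ℕ) : Finset (Fin N → ℕ) :=
  (Finset.piAntidiag Finset.univ n).filter Antitone

theorem mem_partSeq {N n : ℕ} {μ : Fin N → ℕ} :
    μ ∈ partSeq N n ↔ ∑ i, μ i = n ∧ Antitone μ := by
  simp [partSeq]

/-- The sum of the Jacobi-Trudi determinants of the partitions of `2 * n` with even parts and at
most `N` parts. -/
noncomputable def evenSum (f : ℤ → R) (N n : ℕ) : R :=
  ∑ μ ∈ partSeq N n, jacobiTrudi f N (fun i => 2 * (μ i : ℤ))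

theorem antitone_sub_ind_of_ne_zero (f : ℤ → R) (m : ℕ) {μ : Fin (m + 1) → ℕ} (hμ : Antitone μ)
    (S : Finset (Fin (m + 1)))
    (h : jacobiTrudi f (m + 1) ((fun i => 2 * (μ i : ℤ)) - ind S) ≠ 0) :
    Antitone fun i => (μ i : ℤ) - ind S i := by
  rw [Fin.antitone_iff_succ_le]
  intro i
  by_contra hlt
  push Not at hlt
  have hle : μ i.succ ≤ μ i.castSucc := hμ (Fin.castSucc_lt_succ).le
  refine h (jacobiTrudi_eq_zero_of_step f m _ i ?_)
  simp only [ind, Pi.sub_apply] at hlt ⊢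
  split_ifs at hlt ⊢ <;> omega

theorem ind_le_of_ne_zero (f : ℤ → R) (hf : ∀ z < 0, f z = 0) (m : ℕ) {μ : Fin (m + 1) → ℕ}
    (hμ : Antitone μ) (S : Finset (Fin (m + 1)))
    (h : jacobiTrudi f (m + 1) ((fun i => 2 * (μ i : ℤ)) - ind S) ≠ 0) (i : Fin (m + 1)) :
    ind S i ≤ μ i := by
  have h1 := antitone_sub_ind_of_ne_zero f m hμ S h (Fin.le_last i)
  have h2 : ¬ (((fun i => 2 * (μ i : ℤ)) - ind S) (Fin.last m) < 0) := fun hneg =>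
    h (jacobiTrudi_eq_zero_of_last_neg f hf m _ hneg)
  simp only [ind, Pi.sub_apply] at h1 h2 ⊢
  split_ifs at h1 h2 ⊢ <;> omega

theorem antitone_add_ind_of_ne_zero (f : ℤ → R) (m : ℕ) {ν : Fin (m + 1) → ℕ} (hν : Antitone ν)
    (S : Finset (Fin (m + 1)))
    (h : jacobiTrudi f (m + 1) ((fun i => 2 * (ν i : ℤ)) + ind S) ≠ 0) :
    Antitone fun i => (ν i : ℤ) + ind S i := by
  rw [Fin.antitone_iff_succ_le]
  intro i
  by_contra hlt
  push Not at hlt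
  have hle : ν i.succ ≤ ν i.castSucc := hν (Fin.castSucc_lt_succ).le
  refine h (jacobiTrudi_eq_zero_of_step f m _ i ?_)
  simp only [ind, Pi.add_apply] at hlt ⊢
  split_ifs at hlt ⊢ <;> omega

theorem ind_nonneg {N : ℕ} (S : Finset (Fin N)) (i : Fin N) : 0 ≤ ind S i := by
  unfold ind; split_ifs <;> simp

theorem sum_ind {N : ℕ} (S : Finset (Fin N)) : ∑ i, ind S i = S.card := by
  simp [ind]

theorem sum_jacobiTrudi_sub_ind (f : ℤ → R) (hf : ∀ z < 0, f z = 0) (m n : ℕ)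
    (S : Finset (Fin (m + 1))) :
    ∑ μ ∈ partSeq (m + 1) n, jacobiTrudi f (m + 1) ((fun i => 2 * (μ i : ℤ)) - ind S) =
      if S.card < n + 1 then ∑ ν ∈ partSeq (m + 1) (n - S.card),
        jacobiTrudi f (m + 1) ((fun i => 2 * (ν i : ℤ)) + ind S) else 0 := by
  split_ifs with hS
  · refine Finset.sum_bij_ne_zero (fun μ _ _ i => ((μ i : ℤ) - ind S i).toNat) ?_ ?_ ?_ ?_
    · intro μ hμ h
      rw [mem_partSeq] at hμ ⊢
      have h1 := ind_le_of_ne_zero f hf m hμ.2 S h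
      refine ⟨?_, fun i j hij => Int.toNat_le_toNat (antitone_sub_ind_of_ne_zero f m hμ.2 S h hij)⟩
      have : ((∑ i, ((μ i : ℤ) - ind S i).toNat : ℕ) : ℤ) = n - S.card := by
        rw [Nat.cast_sum, ← sum_ind S, ← hμ.1, Nat.cast_sum, ← Finset.sum_sub_distrib]
        exact Finset.sum_congr rfl fun i _ => Int.toNat_of_nonneg (sub_nonneg.2 (h1 i))
      omega
    · intro μ hμ h μ' hμ' h' e
      rw [mem_partSeq] at hμ hμ'
      funext i
      have h1 := ind_le_of_ne_zero f hf m hμ.2 S h i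
      have h2 := ind_le_of_ne_zero f hf m hμ'.2 S h' i
      have : ((μ i : ℤ) - ind S i).toNat = ((μ' i : ℤ) - ind S i).toNat := congrFun e i
      omega
    · intro ν hν h
      have hν' := mem_partSeq.1 hν
      have hc : ∀ i, (((ν i : ℤ) + ind S i).toNat : ℤ) = ν i + ind S i := fun i =>
        Int.toNat_of_nonneg (add_nonneg (Int.natCast_nonneg _) (ind_nonneg S i))
      refine ⟨fun i => ((ν i : ℤ) + ind S i).toNat, ?_, ?_, ?_⟩
      · rw [mem_partSeq]
        refine ⟨?_, fun i j hij =>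
          Int.toNat_le_toNat (antitone_add_ind_of_ne_zero f m hν'.2 S h hij)⟩
        have : ((∑ i, ((ν i : ℤ) + ind S i).toNat : ℕ) : ℤ) = (n - S.card : ℕ) + S.card := by
          rw [Nat.cast_sum, ← hν'.1, Nat.cast_sum, ← sum_ind S, ← Finset.sum_add_distrib]
          exact Finset.sum_congr rfl fun i _ => hc i
        omega
      · convert h using 2
        funext i
        simp only [Pi.sub_apply, Pi.add_apply, hc]
        ring
      · funext i
        change ((((ν i : ℤ) + ind S i).toNat : ℤ) - ind S i).toNat = ν i
        rw [hc]
        simp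
    · intro μ hμ h
      rw [mem_partSeq] at hμ
      congr 1
      funext i
      have h1 := ind_le_of_ne_zero f hf m hμ.2 S h i
      simp only [Pi.sub_apply, Pi.add_apply]
      rw [Int.toNat_of_nonneg (sub_nonneg.2 h1)]
      ring
  · refine Finset.sum_eq_zero fun μ hμ => ?_
    by_contra h
    rw [mem_partSeq] at hμ
    have h1 := Finset.sum_le_sum fun i (_ : i ∈ Finset.univ) => ind_le_of_ne_zero f hf m hμ.2 S h i
    rw [sum_ind, ← Nat.cast_sum, hμ.1] at h1
    omega

theorem evenSum_sub_mul (f : ℤ → R) (hneg : ∀ z < 0, f z = 0) (m : ℕ) (p : ℕ → R)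
    (hp0 : p 0 = 1) (hp : ∀ k ≥ m + 2, p k = 0)
    (hf : ∀ a > 0, ∑ k ∈ Finset.range (m + 2), p k * f (a - k) = 0) (u : R) (n : ℕ) :
    evenSum (fun z => f z - u * f (z - 1)) (m + 1) n =
      ∑ kl ∈ Finset.HasAntidiagonal.antidiagonal n, u ^ kl.1 * p kl.1 * evenSum f (m + 1) kl.2 := by
  have hl : ∀ S : Finset (Fin (m + 1)), ∀ k l : ℕ,
      ∑ ν ∈ partSeq (m + 1) l, (if k = S.card then
        jacobiTrudi f (m + 1) ((fun i => 2 * (ν i : ℤ)) + ind S) else 0) =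
      if k = S.card then ∑ ν ∈ partSeq (m + 1) l,
        jacobiTrudi f (m + 1) ((fun i => 2 * (ν i : ℤ)) + ind S) else 0 := by
    intro S k l
    split_ifs <;> simp
  calc _ = ∑ S : Finset (Fin (m + 1)), (-u) ^ S.card *
        ∑ μ ∈ partSeq (m + 1) n, jacobiTrudi f (m + 1) ((fun i => 2 * (μ i : ℤ)) - ind S) := by
        simp_rw [Finset.mul_sum]
        rw [Finset.sum_comm]
        refine Finset.sum_congr rfl fun μ _ => ?_
        rw [← jacobiTrudi_add_mul_sub]
        simp only [neg_mul, sub_eq_add_neg]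
    _ = ∑ S : Finset (Fin (m + 1)), ∑ k ∈ Finset.range (n + 1), (-u) ^ k *
        ∑ ν ∈ partSeq (m + 1) (n - k), (if k = S.card then
          jacobiTrudi f (m + 1) ((fun i => 2 * (ν i : ℤ)) + ind S) else 0) := by
        refine Finset.sum_congr rfl fun S _ => ?_
        rw [sum_jacobiTrudi_sub_ind f hneg]
        simp only [hl, mul_ite, mul_zero, Finset.sum_ite_eq', Finset.mem_range]
    _ = ∑ k ∈ Finset.range (n + 1), u ^ k * p k * evenSum f (m + 1) (n - k) := by
        rw [Finset.sum_comm]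
        refine Finset.sum_congr rfl fun k _ => ?_
        rw [← Finset.mul_sum, Finset.sum_comm, evenSum, Finset.mul_sum, Finset.mul_sum]
        refine Finset.sum_congr rfl fun ν _ => ?_
        rw [← mul_jacobiTrudi_eq_sum f m p hp0 hp hf _ (fun i => by positivity) k,
          ← mul_assoc, ← mul_assoc, ← mul_pow]
        simp
    _ = _ := by
        rw [Finset.Nat.sum_antidiagonal_eq_sum_range_succ_mk]

end EvenSum

section Littlewood

open PowerSeries (coeff constantCoeff rescale)

variable {K : Type*} [Field K]

/-- The coefficients of a power series, extended by zero to negative indices. -/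
noncomputable def intCoeff (H : PowerSeries K) (z : ℤ) : K :=
  if 0 ≤ z then coeff z.toNat H else 0

theorem intCoeff_of_neg (H : PowerSeries K) (z : ℤ) (hz : z < 0) : intCoeff H z = 0 :=
  if_neg (not_le.2 hz)

theorem intCoeff_natCast (H : PowerSeries K) (n : ℕ) : intCoeff H n = coeff n H := by
  simp [intCoeff]

theorem intCoeff_mul_one_sub (H : PowerSeries K) (u : K) :
    intCoeff (H * (1 - PowerSeries.C u * PowerSeries.X)) =
      fun z => intCoeff H z - u * intCoeff H (z - 1) := by
  funext z
  have e : H * (1 - PowerSeries.C u * PowerSeries.X) =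
      H - PowerSeries.C u * (H * PowerSeries.X) := by ring
  rw [e]
  rcases lt_trichotomy z 0 with hz | rfl | hz
  · rw [intCoeff_of_neg _ _ hz, intCoeff_of_neg _ _ hz, intCoeff_of_neg _ _ (by omega)]; simp
  · rw [intCoeff_of_neg H (0 - 1) (by omega)]
    simp [intCoeff]
  · obtain ⟨n, rfl⟩ : ∃ n : ℕ, z = (n + 1 : ℕ) := ⟨(z - 1).toNat, by omega⟩
    rw [show ((n + 1 : ℕ) : ℤ) - 1 = n by push_cast; ring]
    simp only [intCoeff_natCast]
    simp [PowerSeries.coeff_succ_mul_X]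

theorem sum_mul_intCoeff_eq_zero (H : PowerSeries K) (P : Polynomial K)
    (hHP : H * (P : PowerSeries K) = 1) (N : ℕ) (hN : P.natDegree ≤ N) (a : ℤ) (ha : a > 0) :
    ∑ k ∈ Finset.range (N + 1), P.coeff k * intCoeff H (a - k) = 0 := by
  obtain ⟨n, rfl⟩ : ∃ n : ℕ, a = (n + 1 : ℕ) := ⟨(a - 1).toNat, by omega⟩
  have h := congrArg (PowerSeries.coeff (n + 1)) hHP
  rw [mul_comm, PowerSeries.coeff_mul, PowerSeries.coeff_one, if_neg (by omega),
    Finset.Nat.sum_antidiagonal_eq_sum_range_succ_mk] at h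
  rw [← h]
  have h1 : ∑ k ∈ Finset.range (N + 1), P.coeff k * intCoeff H ((n + 1 : ℕ) - k) =
      ∑ k ∈ Finset.range (N + 1 + (n + 2)), P.coeff k * intCoeff H ((n + 1 : ℕ) - k) := by
    refine Finset.sum_subset (Finset.range_mono (by omega)) fun k _ hk => ?_
    rw [Finset.mem_range] at hk
    rw [Polynomial.coeff_eq_zero_of_natDegree_lt (by omega), zero_mul]
  have h2 : ∑ k ∈ Finset.range (n + 2), P.coeff k * intCoeff H ((n + 1 : ℕ) - k) =
      ∑ k ∈ Finset.range (N + 1 + (n + 2)), P.coeff k * intCoeff H ((n + 1 : ℕ) - k) := by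
    refine Finset.sum_subset (Finset.range_mono (by omega)) fun k _ hk => ?_
    rw [Finset.mem_range] at hk
    rw [intCoeff_of_neg _ _ (by omega), mul_zero]
  rw [h1, ← h2]
  refine Finset.sum_congr rfl fun k hk => ?_
  rw [Finset.mem_range] at hk
  rw [← Nat.cast_sub (by omega), intCoeff_natCast, Polynomial.coeff_coe]

/-- The generating function of the sums of Schur functions of even partitions with at most
`N` parts, evaluated at the sequence of coefficients of `H`. -/
noncomputable def evenSeries (N : ℕ) (H : PowerSeries K) : PowerSeries K :=
  PowerSeries.mk fun n => evenSum (intCoeff H) N n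

theorem evenSeries_mul_one_sub (m : ℕ) (H : PowerSeries K) (P : Polynomial K)
    (hHP : H * (P : PowerSeries K) = 1) (hP0 : P.coeff 0 = 1) (hm : P.natDegree ≤ m + 1) (u : K) :
    evenSeries (m + 1) (H * (1 - PowerSeries.C u * PowerSeries.X)) =
      rescale u (P : PowerSeries K) * evenSeries (m + 1) H := by
  ext n
  rw [PowerSeries.coeff_mul, evenSeries, PowerSeries.coeff_mk, intCoeff_mul_one_sub,
    evenSum_sub_mul _ (intCoeff_of_neg H) m P.coeff hP0
      (fun k hk => Polynomial.coeff_eq_zero_of_natDegree_lt (by omega))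
      (sum_mul_intCoeff_eq_zero H P hHP (m + 1) hm)]
  simp [evenSeries]

theorem evenSeries_one (m : ℕ) : evenSeries (m + 1) (1 : PowerSeries K) = 1 := by
  ext n
  rw [evenSeries, PowerSeries.coeff_mk, PowerSeries.coeff_one]
  have hc : ∀ z : ℤ, intCoeff (1 : PowerSeries K) z = if z = 0 then 1 else 0 := by
    intro z
    simp only [intCoeff, PowerSeries.coeff_one]
    split_ifs <;> first | rfl | omega
  split_ifs with hn
  · subst hn
    have : partSeq (m + 1) 0 = {0} := by
      ext μ
      rw [mem_partSeq, Finset.mem_singleton, Finset.sum_eq_zero_iff]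
      refine ⟨fun h => funext fun i => h.1 i (Finset.mem_univ i), ?_⟩
      rintro rfl
      exact ⟨fun _ _ => rfl, antitone_const⟩
    rw [evenSum, this, Finset.sum_singleton, jacobiTrudi]
    convert Matrix.det_one (n := Fin (m + 1)) (R := K)
    ext i j
    simp only [Matrix.of_apply, hc, Matrix.one_apply]
    congr 1
    simp only [Pi.zero_apply, Nat.cast_zero, mul_zero, Fin.ext_iff, eq_iff_iff]
    omega
  · refine Finset.sum_eq_zero fun μ hμ => ?_
    rw [mem_partSeq] at hμ
    refine Matrix.det_eq_zero_of_row_eq_zero 0 fun j => ?_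
    have h0 : μ 0 ≠ 0 := fun h0 => hn <| by
      rw [← hμ.1, Finset.sum_eq_zero]
      exact fun i _ => Nat.le_zero.1 (h0 ▸ hμ.2 (Fin.zero_le i))
    rw [Matrix.of_apply, hc, if_neg]
    change ¬ (2 * (μ 0 : ℤ) + (j : ℤ) - (0 : ℕ) = 0)
    omega

/-- A linear first-order differential equation of power series has at most one solution with a
given constant term. -/
theorem eq_of_X_mul_derivative_eq [CharZero K] {f g Q : PowerSeries K}
    (hQ : constantCoeff Q = 0)
    (hf : PowerSeries.X * PowerSeries.derivative K f = Q * f)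
    (hg : PowerSeries.X * PowerSeries.derivative K g = Q * g)
    (h0 : constantCoeff f = constantCoeff g) : f = g := by
  ext n
  induction n using Nat.strong_induction_on with
  | _ n ih =>
    rcases n with _ | n
    · simpa using h0
    · have key : ∀ e : PowerSeries K, PowerSeries.X * PowerSeries.derivative K e = Q * e →
          coeff (n + 1) e * (n + 1) = ∑ kl ∈ Finset.HasAntidiagonal.antidiagonal n,
            coeff (kl.1 + 1) Q * coeff kl.2 e := by
        intro e he
        have h := congrArg (PowerSeries.coeff (n + 1)) he
        rw [PowerSeries.coeff_succ_X_mul, PowerSeries.coeff_derivative, PowerSeries.coeff_mul,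
          Finset.Nat.antidiagonal_succ] at h
        simpa [hQ] using h
      have hn : (n + 1 : K) ≠ 0 := by exact_mod_cast Nat.succ_ne_zero n
      refine mul_right_cancel₀ hn ?_
      rw [key f hf, key g hg]
      refine Finset.sum_congr rfl fun kl hkl => ?_
      have := Finset.HasAntidiagonal.mem_antidiagonal.1 hkl
      rw [ih kl.2 (by omega)]

theorem constantCoeff_rescale (u : K) (f : PowerSeries K) :
    constantCoeff (rescale u f) = constantCoeff f := by
  rw [← PowerSeries.coeff_zero_eq_constantCoeff_apply, PowerSeries.coeff_rescale]
  simp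

theorem X_mul_derivative_rescale (u : K) (f : PowerSeries K) :
    PowerSeries.X * PowerSeries.derivative K (rescale u f) =
      rescale u (PowerSeries.X * PowerSeries.derivative K f) := by
  ext n
  rcases n with _ | n
  · simp
  · simp [PowerSeries.coeff_succ_X_mul, PowerSeries.coeff_derivative, mul_assoc, pow_succ']

theorem exists_inverse_polynomial (N : ℕ) (x : ℕ → K) :
    ∃ (H : PowerSeries K) (P : Polynomial K), P.natDegree ≤ N ∧ P.coeff 0 = 1 ∧
      H * (P : PowerSeries K) = 1 ∧ ∀ i < N, coeff (i + 1) H = x i := by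
  set F : PowerSeries K := PowerSeries.mk fun n => if n = 0 then 1 else x (n - 1) with hF
  have hF0 : constantCoeff F = 1 := by
    rw [← PowerSeries.coeff_zero_eq_constantCoeff_apply, hF, PowerSeries.coeff_mk, if_pos rfl]
  set P : Polynomial K := PowerSeries.trunc (N + 1) F⁻¹ with hP
  have hP0 : P.coeff 0 = 1 := by
    simp [hP, PowerSeries.coeff_trunc, hF0]
  have hc : constantCoeff (P : PowerSeries K) = 1 := by
    rw [← PowerSeries.coeff_zero_eq_constantCoeff_apply, Polynomial.coeff_coe, hP0]
  have hc' : constantCoeff (P : PowerSeries K) ≠ 0 := by simp [hc]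
  refine ⟨(P : PowerSeries K)⁻¹, P, ?_, hP0, PowerSeries.inv_mul_cancel _ hc', ?_⟩
  · exact Nat.lt_succ_iff.1 (PowerSeries.natDegree_trunc_lt _ N)
  · intro i hi
    have hFF : F * F⁻¹ = 1 := PowerSeries.mul_inv_cancel _ (by simp [hF0])
    have e : F - (P : PowerSeries K)⁻¹ =
        F * ((P : PowerSeries K) - F⁻¹) * (P : PowerSeries K)⁻¹ := by
      have := PowerSeries.mul_inv_cancel _ hc'
      linear_combination (-F) * this + (P : PowerSeries K)⁻¹ * hFF
    have hdvd : (PowerSeries.X : PowerSeries K) ^ (N + 1) ∣ F - (P : PowerSeries K)⁻¹ := by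
      rw [e]
      refine Dvd.dvd.mul_right (Dvd.dvd.mul_left ?_ _) _
      rw [PowerSeries.X_pow_dvd_iff]
      intro k hk
      rw [map_sub, Polynomial.coeff_coe, hP, PowerSeries.coeff_trunc, if_pos hk, sub_self]
    have := PowerSeries.X_pow_dvd_iff.1 hdvd (i + 1) (by omega)
    rw [map_sub, sub_eq_zero] at this
    rw [← this]
    simp [hF]

variable [Algebra ℚ K]

/-- Evaluation of symmetric functions at the homomorphism with `∑ h_n t^n ↦ H`. -/
noncomputable def evalAt (H : PowerSeries K) : SymF →ₐ[ℚ] K :=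
  aeval fun i => coeff (i + 1) H

/-- The generating function `∑_{n ≥ 1} p_n t^n` of power sums. -/
noncomputable def powerSeriesP (H : PowerSeries K) : PowerSeries K :=
  PowerSeries.mk fun n => if n = 0 then 0 else evalAt H (pSym n)

/-- The generating function `∑_{n ≥ 1} p_n[h_2] t^n`. -/
noncomputable def powerSeriesQ (H : PowerSeries K) : PowerSeries K :=
  PowerSeries.mk fun n => if n = 0 then 0 else
    (evalAt H (pSym n) ^ 2 + evalAt H (pSym (2 * n))) / 2

/-- The generating function of `h_n[h_2]`. -/
noncomputable def plethSeries (H : PowerSeries K) : PowerSeries K :=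
  PowerSeries.mk fun n => evalAt H (pleth (hh n) (hh 2))

theorem toP_hh (n : ℕ) : toP (hh n) = hInP n := by
  cases n with
  | zero => simp [hh, hInP]
  | succ n => simp [hh, toP]

theorem hInP_succ (n : ℕ) : hInP (n + 1) =
    ((n + 1 : ℚ))⁻¹ • ∑ i ∈ Finset.range (n + 1), X i * hInP (n - i) := by
  rw [hInP]

theorem hInP_zero : hInP 0 = 1 := by
  rw [hInP]

theorem psub_hh_two (k : ℕ) :
    psub k (hh 2) = (2⁻¹ : ℚ) • (pSym k ^ 2 + pSym (2 * k)) := by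
  rw [psub, toP_hh, hInP_succ, Finset.sum_range_succ, Finset.sum_range_one]
  simp [hInP_succ, hInP_zero, sq]
  norm_num

theorem evalAt_hh (H : PowerSeries K) (h0 : constantCoeff H = 1) (n : ℕ) :
    evalAt H (hh n) = coeff n H := by
  cases n with
  | zero => simp [hh, h0]
  | succ n => simp [hh, evalAt]

theorem X_mul_derivative_eq (H : PowerSeries K) (h0 : constantCoeff H = 1) :
    PowerSeries.X * PowerSeries.derivative K H = powerSeriesP H * H := by
  ext n
  rcases n with _ | n
  · simp [powerSeriesP]
  · rw [PowerSeries.coeff_succ_X_mul, PowerSeries.coeff_derivative, PowerSeries.coeff_mul,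
      Finset.Nat.antidiagonal_succ, Finset.sum_cons, Finset.sum_map,
      Finset.Nat.sum_antidiagonal_eq_sum_range_succ_mk, Finset.sum_range_succ]
    have h := congrArg (evalAt H) (show pSym (n + 1) = _ by rw [pSym])
    rw [Finset.sum_attach (Finset.range n) (fun i => pSym (i + 1) * hh (n - i))] at h
    simp only [map_sub, map_sum, map_mul, evalAt_hh H h0, Algebra.smul_def, map_add,
      map_natCast, map_one] at h
    simp [powerSeriesP, h0, h]
    ring

theorem X_mul_derivative_plethSeries [CharZero K] (H : PowerSeries K) :
    PowerSeries.X * PowerSeries.derivative K (plethSeries H) =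
      powerSeriesQ H * plethSeries H := by
  ext n
  rcases n with _ | n
  · simp [powerSeriesQ]
  · rw [PowerSeries.coeff_succ_X_mul, PowerSeries.coeff_derivative, PowerSeries.coeff_mul,
      Finset.Nat.antidiagonal_succ, Finset.sum_cons, Finset.sum_map,
      Finset.Nat.sum_antidiagonal_eq_sum_range_succ_mk]
    have hn : (n + 1 : K) ≠ 0 := by exact_mod_cast Nat.succ_ne_zero n
    simp only [plethSeries, PowerSeries.coeff_mk, pleth, toP_hh, hInP_succ n]
    simp [powerSeriesQ, psub_hh_two, Algebra.smul_def]
    field_simp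

theorem powerSeriesP_mul_one_sub (H : PowerSeries K) (h0 : constantCoeff H = 1) (u : K) :
    powerSeriesP (H * (1 - PowerSeries.C u * PowerSeries.X)) =
      powerSeriesP H - PowerSeries.mk fun n => if n = 0 then 0 else u ^ n := by
  set G : PowerSeries K := PowerSeries.mk fun n => if n = 0 then 0 else u ^ n with hG
  set H' := H * (1 - PowerSeries.C u * PowerSeries.X) with hH'
  have hG1 : G * (1 - PowerSeries.C u * PowerSeries.X) = PowerSeries.C u * PowerSeries.X := by
    have e : G * (1 - PowerSeries.C u * PowerSeries.X) =
      G - PowerSeries.C u * (G * PowerSeries.X) := by ring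
    rw [e]
    ext n
    rcases n with _ | _ | n
    · simp [hG]
    · simp [hG, PowerSeries.coeff_succ_mul_X]
    · simp [hG, PowerSeries.coeff_succ_mul_X, pow_succ']
  have h0' : constantCoeff H' = 1 := by simp [hH', h0]
  have hne : H' ≠ 0 := by
    intro h
    simp [h] at h0'
  refine mul_right_cancel₀ hne ?_
  rw [← X_mul_derivative_eq H' h0', hH', Derivation.leibniz]
  have hd : PowerSeries.derivative K (1 - PowerSeries.C u * PowerSeries.X) = -PowerSeries.C u := by
    rw [map_sub, Derivation.leibniz, PowerSeries.derivative_X, PowerSeries.derivative_C]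
    simp
  rw [hd, smul_eq_mul, smul_eq_mul]
  linear_combination (1 - PowerSeries.C u * PowerSeries.X) * X_mul_derivative_eq H h0 + H * hG1

theorem powerSeriesQ_mul_one_sub [CharZero K] (H : PowerSeries K) (h0 : constantCoeff H = 1)
    (u : K) : powerSeriesQ (H * (1 - PowerSeries.C u * PowerSeries.X)) =
      powerSeriesQ H - rescale u (powerSeriesP H) := by
  have key : ∀ n, n ≠ 0 → evalAt (H * (1 - PowerSeries.C u * PowerSeries.X)) (pSym n) =
      evalAt H (pSym n) - u ^ n := by
    intro n hn
    have h := congrArg (PowerSeries.coeff n) (powerSeriesP_mul_one_sub H h0 u)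
    simpa [powerSeriesP, hn] using h
  ext n
  by_cases hn : n = 0
  · subst hn
    simp only [PowerSeries.coeff_zero_eq_constantCoeff_apply, map_sub, constantCoeff_rescale]
    simp [powerSeriesQ, powerSeriesP, ← PowerSeries.coeff_zero_eq_constantCoeff_apply,
      - PowerSeries.coeff_zero_eq_constantCoeff]
  · simp only [powerSeriesQ, powerSeriesP, PowerSeries.coeff_mk, map_sub, hn, if_false,
      PowerSeries.coeff_rescale, key n hn, key (2 * n) (by omega)]
    ring

theorem constantCoeff_plethSeries (H : PowerSeries K) : constantCoeff (plethSeries H) = 1 := by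
  rw [← PowerSeries.coeff_zero_eq_constantCoeff_apply, plethSeries, PowerSeries.coeff_mk, pleth,
    toP_hh, hInP_zero]
  simp

theorem plethSeries_mul_one_sub [CharZero K] (H : PowerSeries K) (P : PowerSeries K)
    (hHP : H * P = 1) (h0 : constantCoeff H = 1) (u : K) :
    plethSeries (H * (1 - PowerSeries.C u * PowerSeries.X)) =
      rescale u P * plethSeries H := by
  have hP0 : constantCoeff P = 1 := by
    have := congrArg PowerSeries.constantCoeff hHP
    simpa [h0] using this
  have hP : PowerSeries.X * PowerSeries.derivative K P = -powerSeriesP H * P := by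
    have h := congrArg (PowerSeries.derivative K) hHP
    rw [Derivation.leibniz, Derivation.map_one_eq_zero, smul_eq_mul, smul_eq_mul] at h
    linear_combination (PowerSeries.X * P) * h - P * P * X_mul_derivative_eq H h0 -
      (PowerSeries.X * PowerSeries.derivative K P + powerSeriesP H * P) * hHP
  have hPu := X_mul_derivative_rescale u P
  rw [hP, map_mul, map_neg] at hPu
  refine eq_of_X_mul_derivative_eq (Q := powerSeriesQ H - rescale u (powerSeriesP H))
    ?_ ?_ ?_ ?_
  · rw [map_sub, constantCoeff_rescale]
    simp [powerSeriesQ, powerSeriesP, ← PowerSeries.coeff_zero_eq_constantCoeff_apply,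
      - PowerSeries.coeff_zero_eq_constantCoeff]
  · rw [X_mul_derivative_plethSeries, powerSeriesQ_mul_one_sub H h0]
  · rw [Derivation.leibniz, smul_eq_mul, smul_eq_mul]
    linear_combination rescale u P * X_mul_derivative_plethSeries H + plethSeries H * hPu
  · rw [map_mul, constantCoeff_plethSeries, constantCoeff_plethSeries, constantCoeff_rescale, hP0,
      one_mul]

theorem plethSeries_one [CharZero K] : plethSeries (1 : PowerSeries K) = 1 := by
  have hP : powerSeriesP (1 : PowerSeries K) = 0 := by
    have h := X_mul_derivative_eq (1 : PowerSeries K) (by simp)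
    simpa using h.symm
  have key : ∀ n, n ≠ 0 → evalAt (1 : PowerSeries K) (pSym n) = 0 := by
    intro n hn
    have h := congrArg (PowerSeries.coeff n) hP
    simpa [powerSeriesP, hn] using h
  have hQ : powerSeriesQ (1 : PowerSeries K) = 0 := by
    ext n
    by_cases hn : n = 0
    · simp [powerSeriesQ, hn]
    · simp [powerSeriesQ, hn, key n hn, key (2 * n) (by omega)]
  refine eq_of_X_mul_derivative_eq (Q := 0) (by simp) ?_ (by simp) ?_
  · rw [X_mul_derivative_plethSeries, hQ]
  · simp [constantCoeff_plethSeries]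

/-- Littlewood's identity at sequences `h` whose generating function is the inverse of a
polynomial. -/
theorem plethSeries_eq_evenSeries [CharZero K] [IsAlgClosed K] (m d : ℕ) (hd : d ≤ m + 1)
    (H : PowerSeries K) (P : Polynomial K) (hPd : P.natDegree = d) (hP0 : P.coeff 0 = 1)
    (hHP : H * (P : PowerSeries K) = 1) : plethSeries H = evenSeries (m + 1) H := by
  induction d generalizing H P with
  | zero =>
    rw [Polynomial.eq_C_of_natDegree_eq_zero hPd, hP0] at hHP
    have : H = 1 := by simpa using hHP
    rw [this, plethSeries_one, evenSeries_one]
  | succ d ih =>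
    have hP0' : constantCoeff (P : PowerSeries K) = 1 := by
      rw [← PowerSeries.coeff_zero_eq_constantCoeff_apply, Polynomial.coeff_coe, hP0]
    have h0 : constantCoeff H = 1 := by
      have := congrArg PowerSeries.constantCoeff hHP
      simpa [hP0'] using this
    obtain ⟨r, hr⟩ := IsAlgClosed.exists_root P fun h => by
      have h1 : P.natDegree = 0 := Polynomial.natDegree_eq_of_degree_eq_some h
      omega
    have hr0 : r ≠ 0 := by
      rintro rfl
      rw [Polynomial.IsRoot, ← Polynomial.coeff_zero_eq_eval_zero, hP0] at hr
      exact one_ne_zero hr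
    obtain ⟨P₁, rfl⟩ := Polynomial.dvd_iff_isRoot.2 hr
    have hP₁ : P₁ ≠ 0 := by
      rintro rfl
      simp at hP0
    have hne : (Polynomial.X - Polynomial.C r) ≠ 0 := Polynomial.X_sub_C_ne_zero r
    rw [Polynomial.natDegree_mul hne hP₁, Polynomial.natDegree_X_sub_C] at hPd
    have hfac : (Polynomial.X - Polynomial.C r) * P₁ =
        (1 - Polynomial.C r⁻¹ * Polynomial.X) * (Polynomial.C (-r) * P₁) := by
      have : Polynomial.C r⁻¹ * Polynomial.C r = 1 := by
        rw [← Polynomial.C_mul, inv_mul_cancel₀ hr0, Polynomial.C_1]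
      rw [Polynomial.C_neg]
      linear_combination (-Polynomial.X * P₁) * this
    have hIH := ih (by omega) (H * (1 - PowerSeries.C r⁻¹ * PowerSeries.X))
      (Polynomial.C (-r) * P₁)
      (by rw [Polynomial.natDegree_C_mul (neg_ne_zero.2 hr0)]; omega)
      (by
        rw [hfac] at hP0
        simpa [Polynomial.mul_coeff_zero] using hP0)
      (by
        have h1 := hHP
        rw [hfac] at h1
        push_cast at h1 ⊢
        linear_combination h1)
    rw [plethSeries_mul_one_sub H _ hHP h0, evenSeries_mul_one_sub m H _ hHP hP0
      (by rw [Polynomial.natDegree_mul hne hP₁, Polynomial.natDegree_X_sub_C]; omega)] at hIH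
    refine mul_left_cancel₀ (fun h => ?_) hIH
    have h1 := congrArg PowerSeries.constantCoeff h
    rw [constantCoeff_rescale, hP0'] at h1
    simp at h1

end Littlewood

section Partitions

theorem ofFn_getD_eq_append (l : List ℕ) (N : ℕ) (hN : l.length ≤ N) :
    List.ofFn (fun i : Fin N => l.getD i 0) = l ++ List.replicate (N - l.length) 0 := by
  refine List.ext_getElem (by simp; omega) fun i h1 h2 => ?_
  rw [List.getElem_ofFn, List.getElem_append]
  split_ifs with h
  · simp [h]
  · simp [not_lt.1 h]

theorem filter_append_replicate (l : List ℕ) (hl : l.Pairwise (· ≥ ·)) :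
    ∃ k, l = l.filter (· ≠ 0) ++ List.replicate k 0 := by
  induction l with
  | nil => exact ⟨0, rfl⟩
  | cons a t ih =>
    rw [List.pairwise_cons] at hl
    by_cases ha : a = 0
    · subst ha
      refine ⟨t.length + 1, ?_⟩
      have h0 : ∀ b ∈ t, b = 0 := fun b hb => Nat.le_zero.1 (hl.1 b hb)
      have h1 : t = List.replicate t.length 0 := List.eq_replicate_iff.2 ⟨rfl, h0⟩
      have h2 : t.filter (· ≠ 0) = [] := by
        rw [List.filter_eq_nil_iff]
        intro b hb
        simp [h0 b hb]
      rw [List.filter_cons_of_neg (by simp), h2, List.nil_append, List.replicate_succ, ← h1]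
    · obtain ⟨k, hk⟩ := ih hl.2
      refine ⟨k, ?_⟩
      rw [List.filter_cons_of_pos (by simpa using ha), List.cons_append, ← hk]

theorem coe_sortedParts {N : ℕ} (π : Nat.Partition N) :
    (sortedParts π : Multiset ℕ) = π.parts := by
  rw [sortedParts, Multiset.coe_reverse, Multiset.sort_eq]

theorem pairwise_sortedParts {N : ℕ} (π : Nat.Partition N) :
    (sortedParts π).Pairwise (· ≥ ·) := by
  rw [sortedParts, List.pairwise_reverse]
  exact Multiset.pairwise_sort _ _

theorem mem_sortedParts {N : ℕ} (π : Nat.Partition N) (x : ℕ) :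
    x ∈ sortedParts π ↔ x ∈ π.parts := by
  rw [← coe_sortedParts π, Multiset.mem_coe]

theorem sum_sortedParts {N : ℕ} (π : Nat.Partition N) : (sortedParts π).sum = N := by
  rw [← Multiset.sum_coe, coe_sortedParts, π.parts_sum]

theorem filter_sortedParts {N : ℕ} (π : Nat.Partition N) :
    (sortedParts π).filter (· ≠ 0) = sortedParts π := by
  rw [List.filter_eq_self]
  intro a ha
  have := π.parts_pos ((mem_sortedParts π a).1 ha)
  simp; omega

theorem length_sortedParts_le {N : ℕ} (π : Nat.Partition N) : (sortedParts π).length ≤ N := by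
  have h := List.length_le_sum_of_one_le (sortedParts π) fun a ha =>
    π.parts_pos ((mem_sortedParts π a).1 ha)
  rwa [sum_sortedParts] at h

theorem antitone_getD (l : List ℕ) (hl : l.Pairwise (· ≥ ·)) : Antitone fun i => l.getD i 0 := by
  intro i j hij
  dsimp only
  by_cases hj : j < l.length
  · rcases hij.eq_or_lt with rfl | hij
    · rfl
    · have := List.pairwise_iff_getElem.1 hl i j (by omega) hj hij
      simpa [hj, hij.trans hj] using this
  · rw [List.getD_eq_default _ _ (not_lt.1 hj)]
    exact Nat.zero_le _

theorem sum_even_partitions {M : Type*} [AddCommMonoid M] (n N : ℕ) (hN : 2 * n ≤ N)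
    (F : (Fin N → ℕ) → M) [DecidablePred fun π : Nat.Partition (2 * n) => ∀ x ∈ π.parts, Even x] :
    ∑ π : Nat.Partition (2 * n),
      (if ∀ x ∈ π.parts, Even x then F (fun i => (sortedParts π).getD i 0) else 0) =
      ∑ μ ∈ partSeq N n, F (fun i => 2 * μ i) := by
  have hdbl : ∀ π : Nat.Partition (2 * n), (∀ x ∈ π.parts, Even x) → ∀ i,
      2 * ((sortedParts π).getD i 0 / 2) = (sortedParts π).getD i 0 := by
    intro π hπ i
    refine Nat.two_mul_div_two_of_even ?_
    by_cases hi : i < (sortedParts π).length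
    · rw [List.getD_eq_getElem _ _ hi]
      exact hπ _ ((mem_sortedParts π _).1 (List.getElem_mem hi))
    · rw [List.getD_eq_default _ _ (not_lt.1 hi)]
      exact Even.zero
  have hofFn : ∀ π : Nat.Partition (2 * n),
      List.ofFn (fun i : Fin N => (sortedParts π).getD i 0) =
        sortedParts π ++ List.replicate (N - (sortedParts π).length) 0 := fun π =>
    ofFn_getD_eq_append _ _ ((length_sortedParts_le π).trans hN)
  rw [← Finset.sum_filter]
  refine Finset.sum_bij (fun π _ i => (sortedParts π).getD i 0 / 2) ?_ ?_ ?_ ?_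
  · intro π hπ
    rw [Finset.mem_filter] at hπ
    rw [mem_partSeq]
    constructor
    · have h := congrArg List.sum (hofFn π)
      rw [List.sum_ofFn, List.sum_append, sum_sortedParts, List.sum_replicate, smul_zero,
        add_zero] at h
      rw [← Finset.sum_congr rfl fun (i : Fin N) _ => hdbl π hπ.2 i, ← Finset.mul_sum] at h
      omega
    · intro i j hij
      exact Nat.div_le_div_right (antitone_getD _ (pairwise_sortedParts π) hij)
  · intro π hπ π' hπ' h
    rw [Finset.mem_filter] at hπ hπ'
    have h1 : (fun i : Fin N => (sortedParts π).getD i 0) =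
        fun i : Fin N => (sortedParts π').getD i 0 := by
      funext i
      rw [← hdbl π hπ.2, ← hdbl π' hπ'.2]
      exact congrArg (2 * ·) (congrFun h i)
    have h2 := congrArg (List.filter (· ≠ 0)) (congrArg List.ofFn h1)
    rw [hofFn, hofFn, List.filter_append, List.filter_append, filter_sortedParts,
      filter_sortedParts] at h2
    have h3 : ∀ k, List.filter (· ≠ 0) (List.replicate k 0) = ([] : List ℕ) := fun k =>
      List.filter_eq_nil_iff.2 fun a ha => by simp [List.eq_of_mem_replicate ha]
    rw [h3, h3, List.append_nil, List.append_nil] at h2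
    ext1
    rw [← coe_sortedParts, h2, coe_sortedParts]
  · intro μ hμ
    rw [mem_partSeq] at hμ
    set l₀ := List.ofFn fun i => 2 * μ i with hl₀
    have hpw : l₀.Pairwise (· ≥ ·) := by
      rw [hl₀, List.pairwise_ofFn]
      intro i j hij
      exact Nat.mul_le_mul_left 2 (hμ.2 hij.le)
    obtain ⟨k, hk⟩ := filter_append_replicate l₀ hpw
    set l := l₀.filter (· ≠ 0) with hl
    have hsum : l.sum = 2 * n := by
      have h := congrArg List.sum hk
      rw [hl₀, List.sum_ofFn, ← Finset.mul_sum, hμ.1, List.sum_append, List.sum_replicate,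
        smul_zero, add_zero] at h
      exact h.symm
    have hpos : ∀ x ∈ l, x ≠ 0 := fun x hx => by simpa using List.of_mem_filter hx
    let π : Nat.Partition (2 * n) :=
      ⟨(l : Multiset ℕ), fun {x} hx => Nat.pos_of_ne_zero (hpos x hx), hsum⟩
    have hπ : sortedParts π = l := by
      have hperm : (sortedParts π).Perm l := Multiset.coe_eq_coe.1 (coe_sortedParts π)
      exact hperm.eq_of_pairwise (fun a b _ _ h1 h2 => le_antisymm h2 h1)
        (pairwise_sortedParts π) (hpw.filter _)
    refine ⟨π, ?_, ?_⟩
    · rw [Finset.mem_filter]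
      refine ⟨Finset.mem_univ _, fun x hx => ?_⟩
      have hx' : x ∈ l₀ := List.mem_of_mem_filter hx
      rw [hl₀, List.mem_ofFn] at hx'
      obtain ⟨i, rfl⟩ := hx'
      exact even_two_mul _
    · have hlen : l.length + k = N := by
        have h := congrArg List.length hk
        rw [hl₀, List.length_ofFn, List.length_append, List.length_replicate] at h
        exact h.symm
      have h := hofFn π
      rw [hπ, show N - l.length = k by omega, ← hk, hl₀] at h
      have h1 := List.ofFn_injective h
      funext i
      have h2 : 2 * μ i = l.getD i 0 := (congrFun h1 i).symm
      rw [hπ, ← h2]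
      omega
  · intro π hπ
    rw [Finset.mem_filter] at hπ
    congr 1
    funext i
    exact (hdbl π hπ.2 i).symm

end Partitions

section Evaluation

variable {K : Type*} [Field K] [Algebra ℚ K]

theorem evalAt_hZ (H : PowerSeries K) (h0 : PowerSeries.constantCoeff H = 1) (z : ℤ) :
    evalAt H (hZ z) = intCoeff H z := by
  unfold hZ intCoeff
  split_ifs
  · exact evalAt_hh H h0 _
  · exact map_zero _

theorem jacobiTrudi_getD {R : Type*} [CommRing R] (f : ℤ → R) (hf : ∀ z < 0, f z = 0)
    (h0 : f 0 = 1) (l : List ℕ) (N : ℕ) (hN : l.length ≤ N) :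
    jacobiTrudi f N (fun i => (l.getD i 0 : ℕ)) =
      jacobiTrudi f l.length (fun i => (l.get i : ℕ)) := by
  induction N, hN using Nat.le_induction with
  | base =>
    congr 1
    funext i
    simp
  | succ N hN ih =>
    rw [jacobiTrudi_succ f hf h0, ← ih]
    · rfl
    · rw [Fin.val_last, List.getD_eq_default _ _ hN]
      rfl

theorem evalAt_schur (H : PowerSeries K) (h0 : PowerSeries.constantCoeff H = 1) (l : List ℕ)
    (N : ℕ) (hN : l.length ≤ N) :
    evalAt H (schur l) = jacobiTrudi (intCoeff H) N (fun i => (l.getD i 0 : ℕ)) := by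
  rw [jacobiTrudi_getD _ (intCoeff_of_neg H) (by simp [intCoeff, h0]) l N hN, schur, AlgHom.map_det]
  congr 1
  ext i j
  simp [evalAt_hZ H h0]

/-- A symmetric function vanishes if it vanishes at all sequences whose generating function is
the inverse of a polynomial of sufficiently large degree. -/
theorem eq_zero_of_evalAt_eq_zero [CharZero K] (D : SymF) (N₀ : ℕ)
    (h : ∀ N ≥ N₀, ∀ (H : PowerSeries K) (P : Polynomial K), P.natDegree ≤ N → P.coeff 0 = 1 →
      H * (P : PowerSeries K) = 1 → evalAt H D = 0) : D = 0 := by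
  have hinj : Function.Injective (algebraMap ℚ K) := (algebraMap ℚ K).injective
  refine MvPolynomial.map_injective _ hinj ?_
  rw [map_zero]
  refine MvPolynomial.funext fun x => ?_
  rw [map_zero, MvPolynomial.eval_map]
  set N := N₀ + (D.vars.sup id + 1) with hN
  obtain ⟨H, P, hP, hP0, hHP, hx⟩ := exists_inverse_polynomial N x
  rw [← h N (by omega) H P hP hP0 hHP]
  refine MvPolynomial.eval₂Hom_congr' (f₁ := algebraMap ℚ K) (f₂ := algebraMap ℚ K) rfl ?_ rfl
  intro i hi _
  refine (hx i ?_).symm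
  have : i ≤ D.vars.sup id := Finset.le_sup (f := id) hi
  omega

end Evaluation

open scoped Classical in
/-- Littlewood's formula: `h_n[h_2]` is the sum of the Schur functions `s_λ` over
all partitions `λ` of `2n` with all parts even. -/
theorem littlewood_hn_h2 (n : ℕ) :
    pleth (hh n) (hh 2) =
      ∑ π : Nat.Partition (2 * n),
        if ∀ x ∈ π.parts, Even x then schur (sortedParts π) else 0 := by
  rw [← sub_eq_zero]
  refine eq_zero_of_evalAt_eq_zero (K := ℂ) _ (2 * n + 1) fun N hN H P hP hP0 hHP => ?_
  obtain ⟨m, rfl⟩ : ∃ m, N = m + 1 := ⟨N - 1, by omega⟩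
  have h0 : PowerSeries.constantCoeff H = 1 := by
    have h := congrArg PowerSeries.constantCoeff hHP
    rwa [map_mul, ← PowerSeries.coeff_zero_eq_constantCoeff_apply (P : PowerSeries ℂ),
      Polynomial.coeff_coe, hP0, mul_one, map_one] at h
  have h := congrArg (PowerSeries.coeff n) (plethSeries_eq_evenSeries m _ hP H P rfl hP0 hHP)
  rw [plethSeries, evenSeries, PowerSeries.coeff_mk, PowerSeries.coeff_mk, evenSum] at h
  rw [map_sub, h, sub_eq_zero, map_sum]
  have hs := sum_even_partitions n (m + 1) (by omega)
    (fun μ => jacobiTrudi (intCoeff H) (m + 1) (fun i => (μ i : ℕ)))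
  push_cast at hs
  rw [← hs]
  refine Finset.sum_congr rfl fun π _ => ?_
  split_ifs
  · exact (evalAt_schur H h0 _ _ ((length_sortedParts_le π).trans (by omega))).symm
  · exact (map_zero _).symm
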